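/- Fix a > 0 and T₀ > 0, write z' = z + 1/a, and let β(t,x,y,z) = (a/T₀)·(z', 0, 0, t) on the right Rindler wedge RRW = {z + 1/a > |t|}, with u = β/√(Q(β)), A^μ = ∑_ν u^ν∂u^μ/∂x^ν and α = √(Q(β))·A. Then at every point of the RRW and for every ν ∈ {0,1,2,3}, ∂(Q(β))/∂x^ν = −2·√(Q(β))·α_ν, where α_ν = η_{νμ}α^μ are the covariant components of α. -/

import Mathlib

open Real MeasureTheory Filter Topology

noncomputable section

/-- Diagonal of the Minkowski metric diag(1,-1,-1,-1). -/
def ηd : Fin 4 → ℝ := ![1, -1, -1, -1]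

/-- Minkowski quadratic form Q(v) = (v⁰)² − (v¹)² − (v²)² − (v³)². -/
def minkQ (v : Fin 4 → ℝ) : ℝ := ∑ μ, ηd μ * v μ * v μ

/-- Minkowski bilinear form η(v,w). -/
def minkB (v w : Fin 4 → ℝ) : ℝ := ∑ μ, ηd μ * v μ * w μ

/-- Covariant (lowered) components v_μ = η_{μν} v^ν. -/
def lo (v : Fin 4 → ℝ) (μ : Fin 4) : ℝ := ηd μ * v μ

/-- Partial derivative ∂_μ of a scalar function on ℝ⁴. -/
def pd (μ : Fin 4) (f : (Fin 4 → ℝ) → ℝ) (x : Fin 4 → ℝ) : ℝ :=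
  fderiv ℝ f x (Pi.single μ 1)

/-- Four-temperature field β(t,x,y,z) = (a/T₀)(z+1/a, 0, 0, t), with x = (t,x,y,z). -/
def betaF (a T₀ : ℝ) (x : Fin 4 → ℝ) : Fin 4 → ℝ :=
  fun μ => (a / T₀) * ![x 3 + 1 / a, 0, 0, x 0] μ

/-- The right Rindler wedge {z + 1/a > |t|}. -/
def RRW (a : ℝ) : Set (Fin 4 → ℝ) := {x | |x 0| < x 3 + 1 / a}

/-- Flow velocity u = β/√(Q(β)). -/
def uF (a T₀ : ℝ) (x : Fin 4 → ℝ) : Fin 4 → ℝ :=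
  fun μ => betaF a T₀ x μ / Real.sqrt (minkQ (betaF a T₀ x))

/-- Four-acceleration A^μ = u^ν ∂_ν u^μ. -/
def accF (a T₀ : ℝ) (x : Fin 4 → ℝ) : Fin 4 → ℝ :=
  fun μ => ∑ ν, uF a T₀ x ν * pd ν (fun y => uF a T₀ y μ) x

/-- Thermal acceleration α = √(Q(β))·A = A/T. -/
def alphaF (a T₀ : ℝ) (x : Fin 4 → ℝ) : Fin 4 → ℝ :=
  fun μ => Real.sqrt (minkQ (betaF a T₀ x)) * accF a T₀ x μ

lemma minkQ_betaF (a T₀ : ℝ) (x : Fin 4 → ℝ) :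
    minkQ (betaF a T₀ x) = (a / T₀) ^ 2 * ((x 3 + 1 / a) ^ 2 - x 0 ^ 2) := by
  simp [minkQ, betaF, ηd, Fin.sum_univ_four]
  ring

lemma minkQ_betaF_pos {a T₀ : ℝ} (ha : 0 < a) (hT₀ : 0 < T₀) {x : Fin 4 → ℝ} (hx : x ∈ RRW a) :
    0 < minkQ (betaF a T₀ x) := by
  rw [minkQ_betaF]
  have hx' : |x 0| < x 3 + 1 / a := hx
  have : x 0 ^ 2 < (x 3 + 1 / a) ^ 2 := sq_lt_sq' (by linarith [neg_abs_le (x 0)])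
    ((le_abs_self _).trans_lt hx')
  have : 0 < (x 3 + 1 / a) ^ 2 - x 0 ^ 2 := sub_pos.mpr this
  positivity

lemma hasFDerivAt_apply_add (i : Fin 4) (c : ℝ) (x : Fin 4 → ℝ) :
    HasFDerivAt (fun y : Fin 4 → ℝ => y i + c)
      (ContinuousLinearMap.proj (R := ℝ) (φ := fun _ : Fin 4 => ℝ) i) x :=
  (hasFDerivAt_apply i x).add_const c

lemma differentiableAt_betaF (a T₀ : ℝ) (x : Fin 4 → ℝ) (μ : Fin 4) :
    DifferentiableAt ℝ (fun y => betaF a T₀ y μ) x := by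
  fin_cases μ <;> simp [betaF] <;> fun_prop

lemma differentiableAt_minkQ_betaF (a T₀ : ℝ) (x : Fin 4 → ℝ) :
    DifferentiableAt ℝ (fun y => minkQ (betaF a T₀ y)) x := by
  simp only [minkQ_betaF]
  fun_prop

lemma pd_betaF (a T₀ : ℝ) (x : Fin 4 → ℝ) (μ ν : Fin 4) :
    pd ν (fun y => betaF a T₀ y μ) x =
      (a / T₀) * ![(Pi.single ν 1 : Fin 4 → ℝ) 3, 0, 0, (Pi.single ν 1 : Fin 4 → ℝ) 0] μ := by
  have h3 := (hasFDerivAt_apply_add 3 (1 / a) x).const_mul (a / T₀)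
  have h0 := (hasFDerivAt_apply (𝕜 := ℝ) (F' := fun _ : Fin 4 => ℝ) 0 x).const_mul (a / T₀)
  fin_cases μ
  · exact congrArg (· (Pi.single ν 1)) h3.fderiv
  · simp [pd, betaF]
  · simp [pd, betaF]
  · exact congrArg (· (Pi.single ν 1)) h0.fderiv

lemma pd_minkQ_betaF (a T₀ : ℝ) (x : Fin 4 → ℝ) (ν : Fin 4) :
    pd ν (fun y => minkQ (betaF a T₀ y)) x =
      (a / T₀) ^ 2 * (2 * (x 3 + 1 / a) * (Pi.single ν 1 : Fin 4 → ℝ) 3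
        - 2 * x 0 * (Pi.single ν 1 : Fin 4 → ℝ) 0) := by
  have h3 := (hasFDerivAt_apply_add 3 (1 / a) x).pow 2
  have h0 := (hasFDerivAt_apply (𝕜 := ℝ) (F' := fun _ : Fin 4 => ℝ) 0 x).pow 2
  have h := (h3.sub h0).const_mul ((a / T₀) ^ 2)
  simp only [minkQ_betaF]
  refine (congrArg (· (Pi.single ν 1)) h.fderiv).trans ?_
  simp [mul_add]

lemma pd_div_sqrt {f q : (Fin 4 → ℝ) → ℝ} {x : Fin 4 → ℝ} (hf : DifferentiableAt ℝ f x)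
    (hq : DifferentiableAt ℝ q x) (hpos : 0 < q x) (ν : Fin 4) :
    pd ν (fun y => f y / √(q y)) x =
      pd ν f x / √(q x) - f x * pd ν q x / (2 * q x * √(q x)) := by
  have hs : √(q x) ≠ 0 := (Real.sqrt_pos.mpr hpos).ne'
  have h := hf.hasFDerivAt.mul
    ((hasDerivAt_inv hs).comp_hasFDerivAt x (hq.hasFDerivAt.sqrt hpos.ne'))
  refine (congrArg (· (Pi.single ν 1)) h.fderiv).trans ?_
  have e : q x = √(q x) ^ 2 := (Real.sq_sqrt hpos.le).symm
  simp only [pd, smul_apply, add_apply, smul_eq_mul, Function.comp_apply]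
  rw [show 2 * q x * √(q x) = 2 * √(q x) ^ 2 * √(q x) by rw [← e]]
  field_simp
  ring

/-- The integral curves of `β` are hyperbolas: `A = (a/T₀)² (t, 0, 0, z + 1/a) / Q(β)`. -/
lemma accF_eq {a T₀ : ℝ} (ha : 0 < a) (hT₀ : 0 < T₀) {x : Fin 4 → ℝ} (hx : x ∈ RRW a)
    (μ : Fin 4) :
    accF a T₀ x μ =
      (a / T₀) ^ 2 * ![x 0, 0, 0, x 3 + 1 / a] μ / minkQ (betaF a T₀ x) := by
  have hpos := minkQ_betaF_pos ha hT₀ hx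
  have hs : √(minkQ (betaF a T₀ x)) ≠ 0 := (Real.sqrt_pos.mpr hpos).ne'
  have e : minkQ (betaF a T₀ x) = √(minkQ (betaF a T₀ x)) ^ 2 := (Real.sq_sqrt hpos.le).symm
  simp only [accF, uF, pd_div_sqrt (differentiableAt_betaF a T₀ x μ)
    (differentiableAt_minkQ_betaF a T₀ x) hpos, pd_betaF, pd_minkQ_betaF, Fin.sum_univ_four]
  generalize √(minkQ (betaF a T₀ x)) = s at hs e ⊢
  rw [e]
  fin_cases μ <;> simp [betaF] <;> field_simp <;> ring

/-- On the right Rindler wedge, the gradient of β² = Q(β) satisfies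
∂_ν(Q(β)) = −2√(Q(β))·α_ν, with α_ν the covariant components of the thermal
acceleration α = √(Q(β))·A. -/
theorem gradient_of_beta_squared
    (a T₀ : ℝ) (ha : 0 < a) (hT₀ : 0 < T₀) :
    ∀ x ∈ RRW a, ∀ ν : Fin 4,
      pd ν (fun y => minkQ (betaF a T₀ y)) x =
        -2 * Real.sqrt (minkQ (betaF a T₀ x)) * lo (alphaF a T₀ x) ν := by
  intro x hx ν
  have hpos := minkQ_betaF_pos ha hT₀ hx
  have e := Real.sq_sqrt hpos.le
  rw [pd_minkQ_betaF, lo, alphaF, accF_eq ha hT₀ hx]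
  generalize √(minkQ (betaF a T₀ x)) = s at e ⊢
  have hs : s ≠ 0 := by rintro rfl; simp at e; exact hpos.ne e
  rw [← e]
  fin_cases ν <;> simp [ηd] <;> field_simp
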